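/- arXiv:2504.00164 — 2 statements merged into one kernel-verified Lean document; each statement's English description precedes it below -/
import Mathlib

section
/- If x ∈ (0,1) is a quadratic irrational (an irrational root of a quadratic polynomial with integer coefficients), then ?(x) is rational. -/
/-- The `k`-th partial quotient (continued fraction digit) `a_{k+1}` of `x`,
obtained from Mathlib's continued fraction algorithm; `0` if the expansion
has terminated. -/
noncomputable def cfDigit (x : ℝ) (k : ℕ) : ℕ :=
  (((GenContFract.of x).partDens.get? k).map fun r => (⌊r⌋).toNat).getD 0

/-- The Minkowski question-mark function, defined by
`?([a₀; a₁, a₂, …]) = a₀ + 2 ∑_{k≥1} (-1)^{k+1} / 2^{a₁+⋯+a_k}`,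
where terms beyond the termination of a finite continued fraction are `0`. -/
noncomputable def minkowski (x : ℝ) : ℝ :=
  (⌊x⌋ : ℝ) + ∑' k : ℕ,
    if ((GenContFract.of x).partDens.get? k).isSome then
      2 * (-1 : ℝ) ^ k / 2 ^ (∑ i ∈ Finset.range (k + 1), cfDigit x i)
    else 0

/-- The Gauss map. -/
noncomputable def gT (x : ℝ) : ℝ := Int.fract x⁻¹

/-- First digit. -/
noncomputable def gd (x : ℝ) : ℕ := (⌊x⁻¹⌋).toNat

/-- irrational in the open unit interval -/
def IrrI (x : ℝ) : Prop := Irrational x ∧ 0 < x ∧ x < 1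

lemma irr_fract {v : ℝ} (h : Irrational v) : IrrI (Int.fract v) := by
  have h1 : Irrational (Int.fract v) := by
    rw [← Int.self_sub_floor]; exact h.sub_intCast _
  exact ⟨h1, lt_of_le_of_ne (Int.fract_nonneg v) h1.ne_zero.symm, Int.fract_lt_one v⟩

lemma irrI_gT {x : ℝ} (h : IrrI x) : IrrI (gT x) := irr_fract h.1.inv

lemma irrI_iter {x : ℝ} (h : IrrI x) (n : ℕ) : IrrI (gT^[n] x) := by
  induction n with
  | zero => simpa using h
  | succ k ih => rw [Function.iterate_succ_apply']; exact irrI_gT ih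

lemma floor_ge {x : ℝ} (h : IrrI x) : 1 ≤ ⌊x⁻¹⌋ := by
  rw [Int.le_floor]; push_cast
  exact (one_le_inv₀ h.2.1).2 h.2.2.le

lemma gd_ge {x : ℝ} (h : IrrI x) : 1 ≤ gd x := by
  have := floor_ge h
  unfold gd; omega

lemma cf_get (n : ℕ) : ∀ v : ℝ, Irrational v →
    (GenContFract.of v).s.get? n = some ⟨1, (⌊(gT^[n] (Int.fract v))⁻¹⌋ : ℝ)⟩ := by
  induction n with
  | zero =>
    intro v hv
    exact GenContFract.of_s_head (irr_fract hv).1.ne_zero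
  | succ n ih =>
    intro v hv
    rw [GenContFract.of_s_succ, ih _ (irr_fract hv).1.inv]
    rfl

lemma cf_den {x : ℝ} (h : IrrI x) (n : ℕ) :
    (GenContFract.of x).partDens.get? n = some (⌊(gT^[n] x)⁻¹⌋ : ℝ) := by
  have h1 := cf_get n x h.1
  rw [Int.fract_eq_self.2 ⟨h.2.1.le, h.2.2⟩] at h1
  exact GenContFract.partDen_eq_s_b h1

lemma cfDigit_eq {x : ℝ} (h : IrrI x) (n : ℕ) : cfDigit x n = gd (gT^[n] x) := by
  unfold cfDigit
  rw [cf_den h]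
  simp [gd]

/-- summand -/
noncomputable def gt (x : ℝ) (k : ℕ) : ℝ :=
  2 * (-1 : ℝ) ^ k / 2 ^ (∑ i ∈ Finset.range (k + 1), gd (gT^[i] x))

/-- sum -/
noncomputable def gM (x : ℝ) : ℝ := ∑' k, gt x k

lemma mink_eq {x : ℝ} (h : IrrI x) : minkowski x = gM x := by
  unfold minkowski gM gt
  have : ⌊x⌋ = 0 := Int.floor_eq_zero_iff.2 ⟨h.2.1.le, h.2.2⟩
  simp [this, cf_den h, cfDigit_eq h]

lemma gt_summable {x : ℝ} (h : IrrI x) : Summable (gt x) := by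
  have hg : Summable (fun k : ℕ => 2 * (1 / 2 : ℝ) ^ k) := summable_geometric_two.mul_left 2
  refine Summable.of_norm_bounded hg ?_
  intro k
  have h1 : k ≤ ∑ i ∈ Finset.range (k + 1), gd (gT^[i] x) := by
    calc k ≤ ∑ i ∈ Finset.range (k + 1), 1 := by simp
      _ ≤ _ := Finset.sum_le_sum fun i _ => gd_ge (irrI_iter h i)
  unfold gt
  rw [norm_div, norm_mul, norm_pow, norm_neg, norm_one, one_pow, norm_pow, one_div, inv_pow]
  simp only [Real.norm_ofNat, mul_one]
  rw [div_eq_mul_inv]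
  gcongr
  norm_num

lemma gt_succ (x : ℝ) (k : ℕ) : gt x (k + 1) = -(1 / 2 ^ gd x) * gt (gT x) k := by
  unfold gt
  rw [Finset.sum_range_succ']
  simp only [Function.iterate_succ_apply, Function.iterate_zero, id]
  rw [pow_add _ _ (gd x), pow_succ]
  field_simp

lemma gM_step {x : ℝ} (h : IrrI x) :
    gM x = 2 / 2 ^ gd x + -(1 / 2 ^ gd x) * gM (gT x) := by
  unfold gM
  rw [(gt_summable h).tsum_eq_zero_add]
  simp only [gt_succ, tsum_mul_left]
  congr 1
  simp [gt]

lemma gM_iter {x : ℝ} (h : IrrI x) (n : ℕ) :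
    ∃ r s : ℚ, |s| ≤ (1 / 2) ^ n ∧ gM x = r + s * gM (gT^[n] x) := by
  induction n with
  | zero => exact ⟨0, 1, by simp, by simp⟩
  | succ n ih =>
    obtain ⟨r, s, hs, e⟩ := ih
    have h2 := irrI_iter h n
    have e2 := gM_step h2
    set y := gT^[n] x
    refine ⟨r + s * (2 / 2 ^ gd y), s * (-(1 / 2 ^ gd y)), ?_, ?_⟩
    · rw [abs_mul, pow_succ]
      refine mul_le_mul hs ?_ (abs_nonneg _) (by positivity)
      rw [abs_neg, abs_of_nonneg (by positivity)]
      have : (2 : ℚ) ^ 1 ≤ 2 ^ gd y := pow_le_pow_right₀ (by norm_num) (gd_ge h2)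
      apply one_div_le_one_div_of_le (by norm_num)
      linarith
    · rw [Function.iterate_succ_apply', e, e2]
      push_cast
      ring

lemma gM_rat_of_periodic {x : ℝ} (h : IrrI x) (m p : ℕ) (hp : 0 < p)
    (e : gT^[m + p] x = gT^[m] x) : ∃ q : ℚ, gM x = q := by
  obtain ⟨r, s, -, e1⟩ := gM_iter h m
  obtain ⟨r', s', hs', e2⟩ := gM_iter (irrI_iter h m) p
  rw [← Function.iterate_add_apply, add_comm p m, e] at e2
  have hs : s' < 1 := by
    refine (le_abs_self s').trans_lt (hs'.trans_lt ?_)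
    exact pow_lt_one₀ (by norm_num) (by norm_num) hp.ne'
  have hs2 : (1 - s' : ℝ) ≠ 0 := by
    have : (s' : ℝ) < 1 := by exact_mod_cast hs
    linarith
  refine ⟨r + s * (r' / (1 - s')), ?_⟩
  have : gM (gT^[m] x) = r' / (1 - s') := by
    rw [eq_div_iff hs2]; linarith
  rw [e1, this]; push_cast; ring

/-- x and y are the roots of an integral form of discriminant D. -/
def QP (D : ℤ) (x y : ℝ) : Prop :=
  IrrI x ∧ x ≠ y ∧ ∃ A B C : ℤ, A ≠ 0 ∧ (B : ℝ) = -A * (x + y) ∧ (C : ℝ) = A * (x * y) ∧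
    D = B ^ 2 - 4 * A * C

lemma QP_ne {D : ℤ} {x y : ℝ} (h : QP D x y) : y ≠ 0 := by
  rintro rfl
  obtain ⟨hx, -, A, B, C, hA, hB, -, -⟩ := h
  have := hx.1.intCast_mul hA
  apply this.ne_int (-B)
  push_cast; rw [hB]; ring

lemma QP_step {D : ℤ} {x y : ℝ} (h : QP D x y) : QP D (gT x) (y⁻¹ - ⌊x⁻¹⌋) := by
  have hy := QP_ne h
  obtain ⟨hx, hxy, A, B, C, hA, hB, hC, hD⟩ := h
  have hx0 : x ≠ 0 := hx.2.1.ne'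
  refine ⟨irrI_gT hx, ?_, C, B + 2 * ⌊x⁻¹⌋ * C, A + B * ⌊x⁻¹⌋ + C * ⌊x⁻¹⌋ ^ 2, ?_, ?_, ?_, ?_⟩
  · unfold gT
    rw [← Int.self_sub_floor]
    intro e
    exact hxy (inv_injective (sub_left_injective e))
  · rintro rfl
    have hA' : (A : ℝ) ≠ 0 := by exact_mod_cast hA
    have : (A : ℝ) * (x * y) ≠ 0 := by positivity
    exact this (by rw [← hC]; simp)
  · unfold gT
    rw [← Int.self_sub_floor]
    push_cast
    rw [hB, hC]; field_simp; ring
  · unfold gT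
    rw [← Int.self_sub_floor]
    push_cast
    rw [hB, hC]; field_simp; ring
  · rw [hD]; ring

lemma neg_step {x y : ℝ} (hx : IrrI x) (hy : y < 0) : y⁻¹ - ⌊x⁻¹⌋ < 0 := by
  have h1 : (1 : ℝ) ≤ ⌊x⁻¹⌋ := by exact_mod_cast floor_ge hx
  have := inv_lt_zero.2 hy
  linarith

/-- conjugate orbit -/
noncomputable def gY (x y : ℝ) : ℕ → ℝ
  | 0 => y
  | n + 1 => (gY x y n)⁻¹ - ⌊(gT^[n] x)⁻¹⌋

lemma QP_iter {D : ℤ} {x y : ℝ} (h : QP D x y) (n : ℕ) : QP D (gT^[n] x) (gY x y n) := by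
  induction n with
  | zero => exact h
  | succ n ih => rw [Function.iterate_succ_apply']; exact QP_step ih

lemma half_aux {a u v : ℝ} (ha : 1 ≤ a) (hu : 0 < u) (hv1 : v < 1) (e : v = u⁻¹ - a) :
    u * v ≤ 1 / 2 := by
  have h1 : u * v = 1 - a * u := by rw [e]; field_simp
  nlinarith

lemma exists_neg {D : ℤ} {x y : ℝ} (h : QP D x y) : ∃ n, gY x y n < 0 := by
  by_contra! hc
  have hpos : ∀ n, 0 < gY x y n := fun n =>
    lt_of_le_of_ne (hc n) (QP_ne (QP_iter h n)).symm
  have hX := fun n => irrI_iter h.1 n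
  have ha : ∀ n, (1 : ℝ) ≤ ⌊(gT^[n] x)⁻¹⌋ := fun n => by exact_mod_cast floor_ge (hX n)
  have hXs : ∀ n, gT^[n + 1] x = (gT^[n] x)⁻¹ - ⌊(gT^[n] x)⁻¹⌋ := fun n => by
    rw [Function.iterate_succ_apply', gT, Int.self_sub_floor]
  have hYs : ∀ n, gY x y (n + 1) = (gY x y n)⁻¹ - ⌊(gT^[n] x)⁻¹⌋ := fun n => rfl
  have hlt : ∀ n, gY x y n < 1 := fun n => by
    have h1 := hpos (n + 1)
    rw [hYs] at h1
    have h2 := ha n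
    exact (one_lt_inv₀ (hpos n)).1 (by linarith)
  have hstep : ∀ n, |gT^[n] x - gY x y n| =
      (gT^[n] x * gY x y n) * |gT^[n + 1] x - gY x y (n + 1)| := fun n => by
    have p1 := (hX n).2.1
    have p2 := hpos n
    rw [abs_sub_comm (gT^[n] x), hXs, hYs]
    rw [← abs_of_pos (mul_pos p1 p2)]
    rw [← abs_mul]
    congr 1
    field_simp
    ring
  have h4 : ∀ n, |gT^[n] x - gY x y n| ≤ 1 / 4 * |gT^[n + 2] x - gY x y (n + 2)| := fun n => by
    rw [hstep n, hstep (n + 1), ← mul_assoc]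
    refine mul_le_mul_of_nonneg_right ?_ (abs_nonneg _)
    have a1 := half_aux (ha n) (hX n).2.1 (hX (n + 1)).2.2 (hXs n)
    have a2 := half_aux (ha n) (hpos n) (hlt (n + 1)) (hYs n)
    have b1 := mul_pos (hpos n) (hpos (n + 1))
    have := mul_le_mul a1 a2 b1.le (by norm_num)
    calc _ = gT^[n] x * gT^[n + 1] x * (gY x y n * gY x y (n + 1)) := by ring
      _ ≤ _ := this
      _ = _ := by norm_num
  have h5 : ∀ n, |x - y| ≤ (1 / 4) ^ n * |gT^[2 * n] x - gY x y (2 * n)| := fun n => by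
    induction n with
    | zero => simp [gY]
    | succ n ih =>
      refine ih.trans ?_
      rw [pow_succ, mul_assoc]
      exact mul_le_mul_of_nonneg_left (h4 (2 * n)) (by positivity)
  have h6 : ∀ n, |x - y| ≤ (1 / 4) ^ n := fun n => by
    refine (h5 n).trans ?_
    have : |gT^[2 * n] x - gY x y (2 * n)| ≤ 1 := by
      rw [abs_le]
      have := hX (2 * n)
      constructor <;> linarith [this.2.1, this.2.2, hpos (2 * n), hlt (2 * n)]
    exact mul_le_of_le_one_right (by positivity) this
  have h7 : 0 < |x - y| := abs_pos.2 (sub_ne_zero.2 h.2.1)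
  obtain ⟨n, hn⟩ := exists_pow_lt_of_lt_one h7 (show (1 / 4 : ℝ) < 1 by norm_num)
  exact absurd (h6 n) (not_le.2 hn)

lemma finite_neg (D : ℤ) : {x : ℝ | ∃ y < 0, QP D x y}.Finite := by
  have hf : ((Set.Icc (-D) D) ×ˢ (Set.Icc (-D) D)).Finite :=
    (Set.finite_Icc _ _).prod (Set.finite_Icc _ _)
  refine (hf.image (fun p : ℤ × ℤ =>
    ((-p.2 / p.1 + Real.sqrt D / |(p.1 : ℝ)|) / 2 : ℝ))).subset ?_
  rintro x ⟨y, hy, hx, hxy, A, B, C, hA, hB, hC, hD⟩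
  have hA' : (A : ℝ) ≠ 0 := by exact_mod_cast hA
  have hAC : A * C < 0 := by
    have : (A : ℝ) * C < 0 := by
      rw [hC, ← mul_assoc, ← mul_assoc]
      have : 0 < (A : ℝ) * A * x := mul_pos (mul_self_pos.2 hA') hx.2.1
      exact mul_neg_of_pos_of_neg this hy
    exact_mod_cast this
  have hC0 : C ≠ 0 := by rintro rfl; simp at hAC
  have hAle : |A| ≤ D := by
    have h1 : |A| * |C| = - (A * C) := by rw [← abs_mul, abs_of_neg hAC]
    have h2 : 1 ≤ |C| := Int.one_le_abs hC0
    nlinarith [abs_nonneg A, sq_nonneg B]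
  have hBle : |B| ≤ D := by
    have h1 : |B| ≤ B ^ 2 := by
      rw [← sq_abs]
      rcases eq_or_lt_of_le (abs_nonneg B) with h | h
      · rw [← h]; simp
      · nlinarith
    nlinarith
  refine ⟨(A, B), ⟨abs_le.1 hAle, abs_le.1 hBle⟩, ?_⟩
  have hs : Real.sqrt D = |(A : ℝ)| * (x - y) := by
    have : (D : ℝ) = (|(A : ℝ)| * (x - y)) ^ 2 := by
      rw [hD]; push_cast; rw [hB, hC, mul_pow |(A : ℝ)|, sq_abs]; ring
    rw [this, Real.sqrt_sq]
    exact mul_nonneg (abs_nonneg _) (by linarith [hx.2.1])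
  simp only
  rw [hs, hB]
  have : |(A : ℝ)| ≠ 0 := abs_ne_zero.2 hA'
  field_simp
  ring

lemma periodic_of_QP {D : ℤ} {x y : ℝ} (h : QP D x y) :
    ∃ m p : ℕ, 0 < p ∧ gT^[m + p] x = gT^[m] x := by
  obtain ⟨N, hN⟩ := exists_neg h
  have hneg : ∀ k, gY x y (N + k) < 0 := fun k => by
    induction k with
    | zero => exact hN
    | succ k ih => exact neg_step (irrI_iter h.1 (N + k)) ih
  have hmem : ∀ k, gT^[N + k] x ∈ {x : ℝ | ∃ y < 0, QP D x y} := fun k =>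
    ⟨_, hneg k, QP_iter h _⟩
  have : Finite {x : ℝ | ∃ y < 0, QP D x y} := finite_neg D
  obtain ⟨i, j, hij, e⟩ := Finite.exists_ne_map_eq_of_infinite
    (fun k : ℕ => (⟨gT^[N + k] x, hmem k⟩ : {x : ℝ | ∃ y < 0, QP D x y}))
  have e' : gT^[N + i] x = gT^[N + j] x := congrArg Subtype.val e
  rcases lt_or_gt_of_ne hij with hl | hl
  · exact ⟨N + i, j - i, by omega, by
      rw [e', show N + i + (j - i) = N + j by omega]⟩
  · exact ⟨N + j, i - j, by omega, by
      rw [← e', show N + j + (i - j) = N + i by omega]⟩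

/-- If `x ∈ (0,1)` is a quadratic irrational, then `?(x)` is rational. -/
theorem minkowski_quadratic_rat (x : ℝ) (hx : x ∈ Set.Ioo (0 : ℝ) 1)
    (hirr : Irrational x)
    (hquad : ∃ a b c : ℤ, a ≠ 0 ∧ (a : ℝ) * x ^ 2 + (b : ℝ) * x + (c : ℝ) = 0) :
    ∃ q : ℚ, minkowski x = (q : ℝ) := by
  obtain ⟨a, b, c, ha, e⟩ := hquad
  have hI : IrrI x := ⟨hirr, hx.1, hx.2⟩
  have ha' : (a : ℝ) ≠ 0 := by exact_mod_cast ha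
  have hQ : QP (b ^ 2 - 4 * a * c) x (-b / a - x) := by
    refine ⟨hI, ?_, a, b, c, ha, ?_, ?_, rfl⟩
    · intro h
      have h2 : (2 * a : ℤ) ≠ 0 := by omega
      apply (hirr.intCast_mul h2).ne_int (-b)
      push_cast
      have : 2 * x = -b / a := by linarith
      rw [eq_div_iff ha'] at this
      linarith
    · field_simp; ring
    · field_simp; linarith
  obtain ⟨m, p, hp, hper⟩ := periodic_of_QP hQ
  rw [mink_eq hI]
  exact gM_rat_of_periodic hI m p hp hper
end

section
/- If x ∈ (0,1) is a quadratic irrational, then ?(x) is a rational number that is not a dyadic rational, i.e., ?(x) ∈ Q \ Z[1/2]. -/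
/-- The Gauss map. -/
noncomputable def gm (t : ℝ) : ℝ := Int.fract t⁻¹

/-- The first digit. -/
noncomputable def dig (t : ℝ) : ℕ := (⌊t⁻¹⌋).toNat

/-- Irrational in the unit interval. -/
def Good (t : ℝ) : Prop := 0 < t ∧ t < 1 ∧ Irrational t

lemma Good.gm {t : ℝ} (h : Good t) : Good (gm t) := by
  obtain ⟨h0, h1, hi⟩ := h
  have hii : Irrational (Int.fract t⁻¹) := by
    unfold Int.fract
    exact (irrational_inv_iff.mpr hi).sub_intCast _
  refine ⟨?_, Int.fract_lt_one _, hii⟩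
  exact lt_of_le_of_ne (Int.fract_nonneg _) (Ne.symm hii.ne_zero)

lemma Good.iter {t : ℝ} (h : Good t) (n : ℕ) : Good (_root_.gm^[n] t) := by
  induction n with
  | zero => exact h
  | succ n ih => rw [Function.iterate_succ_apply']; exact ih.gm

lemma Good.floor {t : ℝ} (h : Good t) : 1 ≤ ⌊t⁻¹⌋ := by
  rw [Int.le_floor]
  simpa using (one_le_inv₀ h.1).mpr h.2.1.le

lemma Good.dig {t : ℝ} (h : Good t) : 1 ≤ dig t := by
  have := h.floor
  unfold _root_.dig
  omega

lemma Good.dig_cast {t : ℝ} (h : Good t) : ((_root_.dig t : ℕ) : ℝ) = (⌊t⁻¹⌋ : ℝ) := by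
  have h1 := h.floor
  have h2 : ((_root_.dig t : ℕ) : ℤ) = ⌊t⁻¹⌋ := by
    unfold _root_.dig
    omega
  exact_mod_cast h2

lemma Good.eq {t : ℝ} (h : Good t) : t * ((_root_.dig t : ℕ) + _root_.gm t) = 1 := by
  rw [h.dig_cast, _root_.gm, Int.floor_add_fract, mul_inv_cancel₀ h.1.ne']

/-- The exponent sums. -/
noncomputable def esum (x : ℝ) (k : ℕ) : ℕ := ∑ i ∈ Finset.range (k + 1), dig (gm^[i] x)

lemma esum_succ (x : ℝ) (k : ℕ) : esum x (k + 1) = dig x + esum (gm x) k := by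
  unfold esum
  rw [Finset.sum_range_succ', add_comm]
  simp [Function.iterate_succ_apply]

lemma esum_zero (x : ℝ) : esum x 0 = dig x := by simp [esum]

lemma esum_ge {x : ℝ} (h : Good x) (k : ℕ) : k + 1 ≤ esum x k := by
  unfold esum
  calc k + 1 = ∑ i ∈ Finset.range (k + 1), 1 := by simp
    _ ≤ _ := Finset.sum_le_sum fun i _ => (h.iter i).dig

/-- The term of the series. -/
noncomputable def term (x : ℝ) (k : ℕ) : ℝ := 2 * (-1 : ℝ) ^ k / 2 ^ esum x k

lemma term_abs {x : ℝ} (h : Good x) (k : ℕ) : ‖term x k‖ ≤ (1 / 2 : ℝ) ^ k := by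
  unfold term
  rw [norm_div, norm_mul, norm_pow, norm_pow, norm_neg, norm_one, one_pow]
  simp only [Real.norm_ofNat, mul_one]
  rw [div_le_iff₀ (by positivity), one_div, inv_pow, inv_mul_eq_div, le_div_iff₀ (by positivity)]
  calc (2 : ℝ) * 2 ^ k = 2 ^ (k + 1) := by ring
    _ ≤ _ := pow_le_pow_right₀ (by norm_num) (esum_ge h k)

lemma term_summable {x : ℝ} (h : Good x) : Summable (term x) :=
  Summable.of_norm_bounded summable_geometric_two (term_abs h)

/-- The question mark function on good points. -/
noncomputable def qm (x : ℝ) : ℝ := ∑' k, term x k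

lemma qm_abs {x : ℝ} (h : Good x) : |qm x| ≤ 2 := by
  have := tsum_of_norm_bounded hasSum_geometric_two (term_abs h)
  simpa [qm] using this

lemma qm_eq {x : ℝ} (h : Good x) : 2 ^ dig x * qm x = 2 - qm (gm x) := by
  unfold qm
  rw [(term_summable h).tsum_eq_zero_add]
  have : ∀ k, term x (k + 1) = (-1 / 2 ^ dig x) * term (gm x) k := by
    intro k
    unfold term
    rw [esum_succ, pow_add, pow_succ]
    field_simp
    ring
  simp_rw [this]
  rw [tsum_mul_left, term, esum_zero]
  field_simp
  ring

lemma two_le_pow_dig {x : ℝ} (h : Good x) : (2 : ℝ) ≤ 2 ^ dig x := by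
  calc (2 : ℝ) = 2 ^ 1 := by norm_num
    _ ≤ _ := pow_le_pow_right₀ (by norm_num) h.dig

lemma qm_nonneg {x : ℝ} (h : Good x) : 0 ≤ qm x := by
  have h1 := qm_eq h
  have h2 := abs_le.mp (qm_abs h.gm)
  have h3 := two_le_pow_dig h
  by_contra hc
  push Not at hc
  nlinarith

lemma qm_le_one {x : ℝ} (h : Good x) : qm x ≤ 1 := by
  have h1 := qm_eq h
  have h2 := qm_nonneg h.gm
  have h3 := two_le_pow_dig h
  by_contra hc
  push Not at hc
  nlinarith

lemma qm_pos {x : ℝ} (h : Good x) : 0 < qm x := by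
  have h1 := qm_eq h
  have h2 := qm_le_one h.gm
  have h3 := two_le_pow_dig h
  by_contra hc
  push Not at hc
  nlinarith

lemma qm_lt_one {x : ℝ} (h : Good x) : qm x < 1 := by
  have h1 := qm_eq h
  have h2 := qm_pos h.gm
  have h3 := two_le_pow_dig h
  by_contra hc
  push Not at hc
  nlinarith

lemma qm_not_dyadic (k : ℕ) : ∀ {x : ℝ}, Good x → ∀ z : ℤ, qm x * 2 ^ k ≠ z := by
  induction k with
  | zero =>
    intro x h z hz
    have h1 := qm_pos h
    have h2 := qm_lt_one h
    simp only [pow_zero, mul_one] at hz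
    rw [hz] at h1 h2
    have h3 : (0 : ℤ) < z := by exact_mod_cast h1
    have h4 : z < (1 : ℤ) := by exact_mod_cast h2
    omega
  | succ k ih =>
    intro x h z hz
    obtain ⟨d, hd⟩ : ∃ d, dig x = d + 1 := ⟨dig x - 1, by have := h.dig; omega⟩
    have h1 := qm_eq h
    rw [hd] at h1
    refine ih h.gm (2 ^ (k + 1) - 2 ^ d * z) ?_
    push_cast
    rw [← hz]
    have : qm (gm x) = 2 - 2 ^ (d + 1) * qm x := by linarith
    rw [this]
    ring

lemma qm_iter {x : ℝ} (h : Good x) (n : ℕ) :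
    ∃ A B : ℤ, (B = 0 → n = 0) ∧ (1 ≤ |B|) ∧ (0 < n → 2 ≤ |B|) ∧ qm (gm^[n] x) = A + B * qm x := by
  induction n with
  | zero => exact ⟨0, 1, by simp, by simp, by simp, by simp⟩
  | succ n ih =>
    obtain ⟨A, B, -, h2, -, h4⟩ := ih
    have h1 := qm_eq (h.iter n)
    have hd := (h.iter n).dig
    rw [← Function.iterate_succ_apply' (f := gm)] at h1
    have h5 : (2 : ℤ) ≤ 2 ^ dig (gm^[n] x) := by
      calc (2 : ℤ) = 2 ^ 1 := by norm_num
        _ ≤ _ := pow_le_pow_right₀ (by norm_num) hd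
    have key : 2 ≤ |-(2 ^ dig (gm^[n] x) * B)| := by
      rw [abs_neg, abs_mul, abs_of_nonneg (by positivity : (0 : ℤ) ≤ 2 ^ dig (gm^[n] x))]
      nlinarith
    refine ⟨2 - 2 ^ dig (gm^[n] x) * A, - (2 ^ dig (gm^[n] x) * B), ?_, by omega, fun _ => key, ?_⟩
    · intro h0
      rw [h0] at key
      simp at key
    · push_cast
      rw [h4] at h1
      linarith

lemma qm_rat_of_periodic {x : ℝ} (h : Good x) {m n : ℕ} (hmn : m < n)
    (he : gm^[m] x = gm^[n] x) : ∃ q : ℚ, qm x = q := by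
  obtain ⟨d, hd, rfl⟩ : ∃ d, 0 < d ∧ n = d + m := ⟨n - m, by omega, by omega⟩
  rw [Function.iterate_add_apply] at he
  obtain ⟨A, B, -, h1, -, h2⟩ := qm_iter h m
  obtain ⟨A', B', -, -, h3, h4⟩ := qm_iter (h.iter m) d
  rw [← he] at h4
  have hB : (B : ℝ) ≠ 0 := by
    intro hb
    have : B = 0 := by exact_mod_cast hb
    rw [this] at h1
    simp at h1
  have hB' : (1 - B' : ℝ) ≠ 0 := by
    intro hb
    have hb1 : (B' : ℝ) = 1 := by linarith
    have : B' = 1 := by exact_mod_cast hb1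
    have h5 := h3 hd
    rw [this] at h5
    simp at h5
  refine ⟨((A' : ℚ) / (1 - B') - A) / B, ?_⟩
  push_cast
  rw [eq_div_iff hB, eq_sub_iff_add_eq, eq_div_iff hB']
  rw [h2] at h4
  linarith

lemma mobius {x : ℝ} (h : Good x) (n : ℕ) :
    ∃ p p' q q' : ℤ, 1 ≤ q ∧ 0 ≤ q' ∧ q' ≤ q ∧ (p * q' - p' * q) ^ 2 = 1 ∧
      x * (q + q' * gm^[n] x) = p + p' * gm^[n] x := by
  induction n with
  | zero => exact ⟨0, 1, 1, 0, by simp, by simp, by simp, by simp, by simp⟩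
  | succ n ih =>
    obtain ⟨p, p', q, q', h1, h2, h3, h4, h5⟩ := ih
    have hd := (h.iter n).dig
    have he := (h.iter n).eq
    have h0 := (h.iter n).1
    rw [← Function.iterate_succ_apply' (f := gm)] at he
    set t := gm^[n] x
    set s := gm^[n + 1] x
    set d := dig t
    have hdz : (1 : ℤ) ≤ (d : ℤ) := by exact_mod_cast hd
    refine ⟨p * d + p', p, q * d + q', q, by nlinarith, by omega, by nlinarith, ?_, ?_⟩
    · rw [← h4]; ring
    · push_cast
      have ht : t ≠ 0 := h0.ne'
      apply mul_left_cancel₀ ht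
      linear_combination h5 + (x * q - p) * he

lemma quad_bound {x a b c : ℝ} (hf : a * x ^ 2 + b * x + c = 0) {p q : ℝ} (hq : 0 ≤ q)
    (h1 : |q * x - p| ≤ 1) (h2 : |q * x - p| * q ≤ 1) :
    |a * p ^ 2 + b * p * q + c * q ^ 2| ≤ |2 * a * x + b| + |a| := by
  have : a * p ^ 2 + b * p * q + c * q ^ 2 =
      - ((2 * a * x + b) * ((q * x - p) * q)) + a * (q * x - p) ^ 2 := by
    linear_combination q ^ 2 * hf
  rw [this]
  refine (abs_add_le _ _).trans ?_
  rw [abs_neg, abs_mul, abs_mul, abs_mul, abs_pow, abs_of_nonneg hq]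
  have ha := abs_nonneg (2 * a * x + b)
  have hb := abs_nonneg a
  have hc := abs_nonneg (q * x - p)
  have h3 : |q * x - p| ^ 2 ≤ 1 := pow_le_one₀ hc h1
  nlinarith [mul_le_mul_of_nonneg_left h2 ha, mul_le_mul_of_nonneg_left h3 hb]

lemma quad_iter {x : ℝ} (h : Good x) {a b c : ℤ}
    (hf : (a : ℝ) * x ^ 2 + (b : ℝ) * x + (c : ℝ) = 0) (n : ℕ) :
    ∃ A B C : ℤ, |(A : ℝ)| ≤ |2 * (a : ℝ) * x + b| + |(a : ℝ)| ∧
      |(C : ℝ)| ≤ |2 * (a : ℝ) * x + b| + |(a : ℝ)| ∧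
      B ^ 2 - 4 * A * C = b ^ 2 - 4 * a * c ∧
      (A : ℝ) * (gm^[n] x) ^ 2 + B * gm^[n] x + C = 0 := by
  obtain ⟨p, p', q, q', h1, h2, h3, h4, h5⟩ := mobius h n
  obtain ⟨t0, t1, -⟩ := h.iter n
  set t := gm^[n] x
  have h1r : (1 : ℝ) ≤ q := by exact_mod_cast h1
  have h2r : (0 : ℝ) ≤ q' := by exact_mod_cast h2
  have h3r : (q' : ℝ) ≤ q := by exact_mod_cast h3
  have h4r : ((p : ℝ) * q' - p' * q) ^ 2 = 1 := by exact_mod_cast h4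
  have hE : (q * x - p) = - (t * (q' * x - p')) := by linear_combination h5
  have hE2 : |q' * x - p'| * (q + q' * t) = 1 := by
    have hpos : (0 : ℝ) ≤ q + q' * t := by positivity
    rw [← abs_of_nonneg hpos, ← abs_mul]
    have : ((q' * x - p') * (q + q' * t)) ^ 2 = 1 := by
      rw [← h4r]
      have : ((q' * x - p') * (q + q' * t)) = (p : ℝ) * q' - p' * q := by
        linear_combination q' * h5
      rw [this]
    rw [← sq_abs] at this
    have h0 := abs_nonneg ((q' * x - p') * (q + q' * t))
    nlinarith
  have n0 := abs_nonneg (q' * x - p')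
  have hEa : |q * x - p| = t * |q' * x - p'| := by
    rw [hE, abs_neg, abs_mul, abs_of_pos t0]
  have hq't : 0 ≤ q' * t := by positivity
  have b1 : |q' * x - p'| * q ≤ 1 := by nlinarith
  have b2 : |q' * x - p'| ≤ 1 := by nlinarith
  have b3 : |q' * x - p'| * q' ≤ 1 := by nlinarith
  have b4 : |q * x - p| ≤ 1 := by rw [hEa]; nlinarith
  have b5 : |q * x - p| * q ≤ 1 := by
    rw [hEa]
    have : 0 ≤ |q' * x - p'| * q := by positivity
    nlinarith
  refine ⟨a * p' ^ 2 + b * p' * q' + c * q' ^ 2,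
    2 * a * p * p' + b * (p * q' + p' * q) + 2 * c * q * q',
    a * p ^ 2 + b * p * q + c * q ^ 2, ?_, ?_, ?_, ?_⟩
  · push_cast
    exact quad_bound hf h2r b2 b3
  · push_cast
    exact quad_bound hf (by linarith) b4 b5
  · linear_combination (b ^ 2 - 4 * a * c) * h4
  · push_cast
    have e : (p : ℝ) = x * (q + q' * t) - p' * t := by linarith
    rw [e]
    linear_combination (q + q' * t) ^ 2 * hf

lemma root_finite {A B C : ℝ} (h : ¬ (A = 0 ∧ B = 0)) :
    {t : ℝ | A * t ^ 2 + B * t + C = 0}.Finite := by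
  open Polynomial in
  let P : Polynomial ℝ := Polynomial.C A * X ^ 2 + Polynomial.C B * X + Polynomial.C C
  have hP : P ≠ 0 := by
    intro hP
    apply h
    constructor
    · have := congrArg (fun P => Polynomial.coeff P 2) hP
      simpa [P, Polynomial.coeff_X, Polynomial.coeff_C] using this
    · have := congrArg (fun P => Polynomial.coeff P 1) hP
      simpa [P, Polynomial.coeff_X, Polynomial.coeff_C] using this
  refine (P.roots.toFinset.finite_toSet).subset ?_
  intro t ht
  simp only [Set.mem_ofPred_eq] at ht
  simp [hP, Polynomial.IsRoot, P, ht]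

lemma orbit_finite {x : ℝ} (h : Good x) {a b c : ℤ} (ha : a ≠ 0)
    (hf : (a : ℝ) * x ^ 2 + (b : ℝ) * x + (c : ℝ) = 0) :
    (Set.range fun n => gm^[n] x).Finite := by
  obtain ⟨K, hK⟩ := exists_nat_ge (|2 * (a : ℝ) * x + b| + |(a : ℝ)|)
  obtain ⟨L, hL⟩ : ∃ L : ℤ, L = |b ^ 2 - 4 * a * c| + 4 * K * K := ⟨_, rfl⟩
  have hD : b ^ 2 - 4 * a * c ≠ 0 := by
    intro hD
    have hDr : (b : ℝ) ^ 2 - 4 * a * c = 0 := by exact_mod_cast hD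
    have h1 : (2 * a * x + b) ^ 2 = 0 := by linear_combination 4 * a * hf + hDr
    have h2 : 2 * a * x + b = 0 := by simpa using h1
    apply h.2.2
    refine ⟨-b / (2 * a), ?_⟩
    have har : (a : ℝ) ≠ 0 := by exact_mod_cast ha
    push_cast
    rw [div_eq_iff (by positivity)]
    linarith
  let T : Set (ℤ × ℤ × ℤ) := (Set.Icc (-(K : ℤ)) K) ×ˢ (Set.Icc (-L) L) ×ˢ (Set.Icc (-(K : ℤ)) K)
  have hT : (T ∩ {u | ¬ (u.1 = 0 ∧ u.2.1 = 0)}).Finite :=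
    ((Set.finite_Icc _ _).prod ((Set.finite_Icc _ _).prod (Set.finite_Icc _ _))).inter_of_left _
  refine (hT.biUnion (t := fun u => {t : ℝ | (u.1 : ℝ) * t ^ 2 + u.2.1 * t + u.2.2 = 0}) ?_).subset ?_
  · intro u hu
    apply root_finite
    have := hu.2
    simp only [Set.mem_ofPred_eq] at this
    exact_mod_cast this
  · rintro _ ⟨n, rfl⟩
    obtain ⟨A, B, C, h1, h2, h3, h4⟩ := quad_iter h hf n
    have h1' : |A| ≤ K := by exact_mod_cast h1.trans hK
    have h2' : |C| ≤ K := by exact_mod_cast h2.trans hK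
    have hAC : |A * C| ≤ K * K := by
      rw [abs_mul]
      exact mul_le_mul h1' h2' (abs_nonneg _) (by positivity)
    have hB2 : B ^ 2 ≤ L := by
      have e1 := le_abs_self (b ^ 2 - 4 * a * c)
      have e2 := le_abs_self (A * C)
      nlinarith
    have hB : |B| ≤ L := by
      have : |B| ≤ B ^ 2 := by
        rw [← sq_abs]
        rcases (abs_nonneg B).eq_or_lt with h0 | h0
        · rw [← h0]; simp
        · nlinarith
      linarith
    simp only [Set.mem_iUnion]
    refine ⟨(A, B, C), ⟨⟨abs_le.mp h1', abs_le.mp hB, abs_le.mp h2'⟩, ?_⟩, h4⟩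
    rintro ⟨hA0, hB0⟩
    simp only at hA0 hB0
    apply hD
    rw [← h3, hA0, hB0]
    simp

lemma stream_eq {x : ℝ} (h : Good x) (n : ℕ) :
    ∃ p, GenContFract.IntFractPair.stream x n = some p ∧ p.fr = gm^[n] x := by
  induction n with
  | zero =>
    refine ⟨_, GenContFract.IntFractPair.stream_zero x, ?_⟩
    simp [GenContFract.IntFractPair.of, Int.fract_eq_self, h.1.le, h.2.1]
  | succ n ih =>
    obtain ⟨p, h1, h2⟩ := ih
    refine ⟨_, GenContFract.IntFractPair.stream_succ_of_some h1 ?_, ?_⟩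
    · rw [h2]; exact (h.iter n).1.ne'
    · rw [Function.iterate_succ_apply', ← h2]; rfl

lemma partDens_eq {x : ℝ} (h : Good x) (n : ℕ) :
    (GenContFract.of x).partDens.get? n = some ((⌊(gm^[n] x)⁻¹⌋ : ℤ) : ℝ) := by
  obtain ⟨p, h1, h2⟩ := stream_eq h n
  have h3 : GenContFract.IntFractPair.stream x (n + 1) = _ :=
    GenContFract.IntFractPair.stream_succ_of_some h1 (by rw [h2]; exact (h.iter n).1.ne')
  have h4 := GenContFract.get?_of_eq_some_of_succ_get?_intFractPair_stream h3
  rw [GenContFract.partDen_eq_s_b h4, h2]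
  rfl

lemma minkowski_eq {x : ℝ} (h : Good x) : minkowski x = qm x := by
  have hfl : ⌊x⌋ = 0 := Int.floor_eq_zero_iff.mpr ⟨h.1.le, h.2.1⟩
  have hd : ∀ k, cfDigit x k = dig (gm^[k] x) := by
    intro k
    simp [cfDigit, partDens_eq h, dig]
  unfold minkowski qm term esum
  simp [hfl, partDens_eq h, hd]

/-- If `x ∈ (0,1)` is a quadratic irrational, then `?(x)` is a rational
number that is not a dyadic rational. -/
theorem minkowski_quadratic_rat_not_dyadic (x : ℝ) (hx : x ∈ Set.Ioo (0 : ℝ) 1)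
    (hirr : Irrational x)
    (hquad : ∃ a b c : ℤ, a ≠ 0 ∧ (a : ℝ) * x ^ 2 + (b : ℝ) * x + (c : ℝ) = 0) :
    (∃ q : ℚ, minkowski x = (q : ℝ)) ∧
    ¬ ∃ (z : ℤ) (k : ℕ), minkowski x = (z : ℝ) / 2 ^ k := by
  have h : Good x := ⟨hx.1, hx.2, hirr⟩
  rw [minkowski_eq h]
  constructor
  · obtain ⟨a, b, c, ha, hf⟩ := hquad
    have hfin := orbit_finite h ha hf
    have hni : ¬ Function.Injective fun n => gm^[n] x := fun hi =>
      Set.infinite_range_of_injective hi hfin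
    rw [Function.not_injective_iff] at hni
    obtain ⟨m, n, he, hne⟩ := hni
    rcases lt_or_gt_of_ne hne with hlt | hlt
    · exact qm_rat_of_periodic h hlt he
    · exact qm_rat_of_periodic h hlt he.symm
  · rintro ⟨z, k, hz⟩
    refine qm_not_dyadic k h z ?_
    rw [hz]
    field_simp
end
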